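/- Let op_0 op_1 ... op_n be a valid sequence of order-2 stack operations. Then for all 0 ≤ i ≤ j ≤ n, push1(j) = i if and only if the factor op_i op_{i+1} ... op_j belongs to the context-free language L1. -/

import Mathlib

/-- Order-2 stack operations over stack alphabet `S`. -/
inductive Op (S : Type) : Type where
  | push1 : S → Op S
  | pop1  : Op S
  | push2 : Op S
  | pop2  : Op S
  | collapse : Op S
  deriving DecidableEq

/-- Annotated stack symbol: (symbol, collapse link, position annotation). -/
abbrev ASym (S : Type) : Type := S × ℕ × ℤ
/-- Annotated order-1 stack, topmost symbol first. -/
abbrev Stk1 (S : Type) : Type := List (ASym S)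
/-- Annotated order-2 stack: list of (position annotation, order-1 stack), topmost first.
In `[[u_1][u_2] ⋯ [u_n]]` the topmost stack `u_n` comes first in the list. -/
abbrev Stk2 (S : Type) : Type := List (ℤ × Stk1 S)

/-- The initial order-2 stack `[[]]`, its unique (empty) order-1 stack annotated `-1`. -/
def initStk (S : Type) : Stk2 S := [(-1, ([] : Stk1 S))]

/-- One step of the annotated semantics; `p` is the current position.
`push1 s` records the collapse link `n-1` (number of stacks below the top) and the
position annotation `p`; `push2` duplicates the top stack annotating the copy with `p`;
`collapse` keeps the bottom `i` order-1 stacks, where `i` is the collapse link of the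
topmost symbol.  Undefined operations yield `none`. -/
def step {S : Type} (p : ℕ) (op : Op S) (W : Stk2 S) : Option (Stk2 S) :=
  match op, W with
  | .push2, t :: rest => some (((p : ℤ), t.2) :: t :: rest)
  | .pop2, _ :: t :: rest => some (t :: rest)
  | .push1 s, (a, u) :: rest => some ((a, (s, rest.length, (p : ℤ)) :: u) :: rest)
  | .pop1, (a, _ :: u) :: rest => some ((a, u) :: rest)
  | .collapse, (_, (_, i, _) :: _) :: _ =>
      if 1 ≤ i ∧ i < W.length then some (W.drop (W.length - i)) else none
  | _, _ => none

def runFrom {S : Type} (p : ℕ) (W : Stk2 S) : List (Op S) → Option (Stk2 S)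
  | [] => some W
  | op :: rest => (step p op W).bind fun W' => runFrom (p + 1) W' rest

/-- `stkAt ops j` is the annotated order-2 stack `W_j` after executing `op_0 ⋯ op_j`
(for `j = -1` this is the initial stack `[[]]`). -/
def stkAt {S : Type} (ops : List (Op S)) (j : ℤ) : Option (Stk2 S) :=
  runFrom 0 (initStk S) (ops.take (j + 1).toNat)

/-- A nonempty sequence of operations is valid if every operation is defined,
starting from the empty order-2 stack `[[]]`. -/
def Valid {S : Type} (ops : List (Op S)) : Prop :=
  ops ≠ [] ∧ (runFrom 0 (initStk S) ops).isSome

/-- `push1At ops j` is `push1(j)`: the position annotation of the topmost symbol of the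
topmost order-1 stack of `W_j`, or `-1` if that stack is empty (also `-1` for `j = -1`). -/
def push1At {S : Type} (ops : List (Op S)) (j : ℤ) : ℤ :=
  match stkAt ops j with
  | some ((_, (_, _, p) :: _) :: _) => p
  | _ => -1

/-- `Push2At ops j` is `Push2(j)`: the position annotation of the topmost order-1 stack
of `W_j` (`-1` for `j = -1`). -/
def Push2At {S : Type} (ops : List (Op S)) (j : ℤ) : ℤ :=
  match stkAt ops j with
  | some ((a, _) :: _) => a
  | _ => -1

mutual
/-- Words derived from the nonterminal `S1` of the grammar
`S1 → ↑1 | S1 ↑2 | S1 S1 ↓1 | S1 S2 ↓2 | S1 S2 S1 ⇓`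
(all letters `↑1(s)` are identified with the single letter `↑1`). -/
inductive InL1 {S : Type} : List (Op S) → Prop where
  | base (s : S) : InL1 [Op.push1 s]
  | push2 (w : List (Op S)) : InL1 w → InL1 (w ++ [Op.push2])
  | pop1 (v w : List (Op S)) : InL1 v → InL1 w → InL1 (v ++ w ++ [Op.pop1])
  | pop2 (v w : List (Op S)) : InL1 v → InL2 w → InL1 (v ++ w ++ [Op.pop2])
  | collapse (v w x : List (Op S)) : InL1 v → InL2 w → InL1 x →
      InL1 (v ++ w ++ x ++ [Op.collapse])

/-- Words derived from the nonterminal `S2` of the grammar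
`S2 → ↑2 | S2 ↑1 | S2 ↓1 | S2 S2 ↓2 | S2 S2 S1 ⇓`. -/
inductive InL2 {S : Type} : List (Op S) → Prop where
  | base : InL2 [Op.push2]
  | push1 (s : S) (w : List (Op S)) : InL2 w → InL2 (w ++ [Op.push1 s])
  | pop1 (w : List (Op S)) : InL2 w → InL2 (w ++ [Op.pop1])
  | pop2 (v w : List (Op S)) : InL2 v → InL2 w → InL2 (v ++ w ++ [Op.pop2])
  | collapse (v w x : List (Op S)) : InL2 v → InL2 w → InL1 x →
      InL2 (v ++ w ++ x ++ [Op.collapse])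
end

/-- The factor `op_i ⋯ op_j` of the sequence. -/
def factor {S : Type} (ops : List (Op S)) (i j : ℕ) : List (Op S) :=
  (ops.drop i).take (j + 1 - i)

namespace Stk

def R {S : Type} (ops : List (Op S)) : Option (Stk2 S) := runFrom 0 (initStk S) ops

theorem runFrom_snoc {S : Type} (ops : List (Op S)) (op : Op S) :
    ∀ (p : ℕ) (W : Stk2 S), runFrom p W (ops ++ [op])
      = (runFrom p W ops).bind (step (p + ops.length) op) := by
  induction ops with
  | nil =>
    intro p W
    simp only [List.nil_append, runFrom, List.length_nil, Nat.add_zero, Option.bind_some]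
    cases step p op W <;> rfl
  | cons o r ih =>
    intro p W
    simp only [List.cons_append, runFrom, List.length_cons]
    cases step p o W with
    | none => rfl
    | some W' =>
      simp only [Option.bind_some, ih]
      congr 2
      omega

theorem R_snoc {S : Type} (ops : List (Op S)) (op : Op S) (W' : Stk2 S)
    (h : R (ops ++ [op]) = some W') : ∃ W, R ops = some W ∧ step ops.length op W = some W' := by
  unfold R at h
  rw [runFrom_snoc, Nat.zero_add] at h
  exact Option.bind_eq_some_iff.mp h

theorem R_append {S : Type} (v : List (Op S)) (w : List (Op S)) : ∀ (W' : Stk2 S),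
    R (v ++ w) = some W' → ∃ W, R v = some W := by
  induction w using List.reverseRecOn with
  | nil => intro W' h; exact ⟨W', by simpa using h⟩
  | append_singleton w o ih =>
    intro W' h
    rw [← List.append_assoc] at h
    obtain ⟨W, h1, _⟩ := R_snoc _ _ _ h
    exact ih _ h1

/-- what a step does, case by case -/
theorem step_push1 {S : Type} {p : ℕ} {s : S} {W W' : Stk2 S} (h : step p (.push1 s) W = some W') :
    ∃ a u rest, W = (a, u) :: rest ∧ W' = (a, (s, rest.length, (p : ℤ)) :: u) :: rest := by
  rcases W with _ | ⟨⟨a, u⟩, rest⟩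
  · simp [step] at h
  · exact ⟨a, u, rest, rfl, by simpa [step] using h.symm⟩

theorem step_push2 {S : Type} {p : ℕ} {W W' : Stk2 S} (h : step p .push2 W = some W') :
    ∃ a u rest, W = (a, u) :: rest ∧ W' = ((p : ℤ), u) :: (a, u) :: rest := by
  rcases W with _ | ⟨⟨a, u⟩, rest⟩
  · simp [step] at h
  · exact ⟨a, u, rest, rfl, by simpa [step] using h.symm⟩

theorem step_pop1 {S : Type} {p : ℕ} {W W' : Stk2 S} (h : step p .pop1 W = some W') :
    ∃ a x u rest, W = (a, x :: u) :: rest ∧ W' = (a, u) :: rest := by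
  rcases W with _ | ⟨⟨a, _ | ⟨x, u⟩⟩, rest⟩
  · simp [step] at h
  · simp [step] at h
  · exact ⟨a, x, u, rest, rfl, by simpa [step] using h.symm⟩

theorem step_pop2 {S : Type} {p : ℕ} {W W' : Stk2 S} (h : step p .pop2 W = some W') :
    ∃ a u, W = (a, u) :: W' ∧ W' ≠ [] := by
  rcases W with _ | ⟨⟨a, u⟩, _ | ⟨t, rest⟩⟩
  · simp [step] at h
  · simp [step] at h
  · have : W' = t :: rest := by simpa [step] using h.symm
    subst this
    exact ⟨a, u, rfl, by simp⟩

theorem step_collapse {S : Type} {p : ℕ} {W W' : Stk2 S} (h : step p .collapse W = some W') :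
    ∃ a s i q u rest, W = (a, (s, i, q) :: u) :: rest ∧ 1 ≤ i ∧ W' = W.drop (W.length - i) := by
  rcases W with _ | ⟨⟨a, _ | ⟨⟨s, i, q⟩, u⟩⟩, rest⟩
  · simp [step] at h
  · simp [step] at h
  · simp only [step] at h
    split_ifs at h with hc
    exact ⟨a, s, i, q, u, rest, rfl, hc.1, (Option.some.inj h).symm⟩

def SymOK {S : Type} (ops : List (Op S)) (u : Stk1 S) (rest : Stk2 S) : Prop :=
  ∀ s l p u', (s, l, p) :: u' <:+ u → ∃ k : ℕ, p = (k : ℤ) ∧ k < ops.length ∧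
    ∃ b rest', R (ops.take k) = some ((b, u') :: rest') ∧ rest' <:+ rest ∧ rest'.length = l

def StkOK {S : Type} (ops : List (Op S)) (a : ℤ) (rest : Stk2 S) : Prop :=
  (a = -1 ∧ rest = []) ∨ ∃ k : ℕ, a = (k : ℤ) ∧ k < ops.length ∧ R (ops.take k) = some rest

def Inv {S : Type} (ops : List (Op S)) (W : Stk2 S) : Prop :=
  ∀ a u rest, (a, u) :: rest <:+ W → StkOK ops a rest ∧ SymOK ops u rest

theorem SymOK.mono {S : Type} {ops : List (Op S)} {u : Stk1 S} {rest : Stk2 S}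
    (h : SymOK ops u rest) (o : Op S) : SymOK (ops ++ [o]) u rest := by
  intro s l p u' hs
  obtain ⟨k, h1, h2, h3⟩ := h s l p u' hs
  refine ⟨k, h1, by simp; omega, ?_⟩
  rwa [List.take_append_of_le_length h2.le]

theorem StkOK.mono {S : Type} {ops : List (Op S)} {a : ℤ} {rest : Stk2 S}
    (h : StkOK ops a rest) (o : Op S) : StkOK (ops ++ [o]) a rest := by
  rcases h with h | ⟨k, h1, h2, h3⟩
  · exact Or.inl h
  · refine Or.inr ⟨k, h1, by simp; omega, ?_⟩
    rwa [List.take_append_of_le_length h2.le]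

theorem Inv.mono {S : Type} {ops : List (Op S)} {W : Stk2 S}
    (h : Inv ops W) (o : Op S) : Inv (ops ++ [o]) W :=
  fun a u rest hs => ⟨(h a u rest hs).1.mono o, (h a u rest hs).2.mono o⟩

theorem Inv.suffix {S : Type} {ops : List (Op S)} {W W' : Stk2 S}
    (h : Inv ops W) (hs : W' <:+ W) : Inv ops W' :=
  fun a u rest h' => h a u rest (h'.trans hs)

theorem Inv.cons {S : Type} {ops : List (Op S)} {a : ℤ} {u : Stk1 S} {W : Stk2 S}
    (h : Inv ops W) (h1 : StkOK ops a W) (h2 : SymOK ops u W) : Inv ops ((a, u) :: W) := by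
  intro a' u' rest' hs
  rcases List.suffix_cons_iff.mp hs with h' | h'
  · simp only [List.cons.injEq, Prod.mk.injEq] at h'
    obtain ⟨⟨rfl, rfl⟩, rfl⟩ := h'
    exact ⟨h1, h2⟩
  · exact h _ _ _ h'

theorem inv {S : Type} (ops : List (Op S)) : ∀ W, R ops = some W → Inv ops W := by
  induction ops using List.reverseRecOn with
  | nil =>
    intro W h
    simp only [R, runFrom, initStk, Option.some.injEq] at h
    subst h
    refine Inv.cons (fun a u rest h => by simp at h) (Or.inl ⟨rfl, rfl⟩) ?_
    intro s l p u' h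
    simp at h
  | append_singleton ops o ih =>
    intro W' h'
    obtain ⟨W, h, hs⟩ := R_snoc _ _ _ h'
    have hI := ih W h
    have hI' := hI.mono o
    have htake : (ops ++ [o]).take ops.length = ops := by simp
    cases o with
    | push1 s =>
      obtain ⟨a, u, rest, rfl, rfl⟩ := step_push1 hs
      obtain ⟨h1, h2⟩ := hI' a u rest (List.suffix_refl _)
      refine Inv.cons (hI'.suffix (List.suffix_cons _ _)) h1 ?_
      intro s' l p u' hsu
      rcases List.suffix_cons_iff.mp hsu with e | e
      · simp only [List.cons.injEq, Prod.mk.injEq] at e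
        obtain ⟨⟨rfl, rfl, rfl⟩, rfl⟩ := e
        exact ⟨ops.length, rfl, by simp, a, rest, by rw [htake, h], List.suffix_refl _, rfl⟩
      · exact h2 _ _ _ _ e
    | push2 =>
      obtain ⟨a, u, rest, rfl, rfl⟩ := step_push2 hs
      obtain ⟨h1, h2⟩ := hI' a u rest (List.suffix_refl _)
      refine Inv.cons hI' (Or.inr ⟨ops.length, rfl, by simp, by rw [htake, h]⟩) ?_
      intro s' l p u' hsu
      obtain ⟨k, e1, e2, b, r, e3, e4, e5⟩ := h2 _ _ _ _ hsu
      exact ⟨k, e1, e2, b, r, e3, e4.trans (List.suffix_cons _ _), e5⟩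
    | pop1 =>
      obtain ⟨a, x, u, rest, rfl, rfl⟩ := step_pop1 hs
      obtain ⟨h1, h2⟩ := hI' a _ rest (List.suffix_refl _)
      refine Inv.cons (hI'.suffix (List.suffix_cons _ _)) h1 ?_
      intro s' l p u' hsu
      exact h2 _ _ _ _ (hsu.trans (List.suffix_cons _ _))
    | pop2 =>
      obtain ⟨a, u, rfl, _⟩ := step_pop2 hs
      exact hI'.suffix (List.suffix_cons _ _)
    | collapse =>
      obtain ⟨a, s, i, q, u, rest, _, _, rfl⟩ := step_collapse hs
      exact hI'.suffix (List.drop_suffix _ _)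

def T1 {S : Type} (W : Stk2 S) (i : ℕ) : Prop :=
  ∃ a s l u rest, W = (a, (s, l, (i : ℤ)) :: u) :: rest
def T2 {S : Type} (W : Stk2 S) (i : ℕ) : Prop :=
  ∃ u rest, W = ((i : ℤ), u) :: rest

theorem T1.uniq {S : Type} {W : Stk2 S} {i j : ℕ} (h : T1 W i) (h' : T1 W j) : i = j := by
  obtain ⟨a, s, l, u, rest, rfl⟩ := h
  obtain ⟨a, s, l, u, rest, h⟩ := h'
  simp at h
  omega

theorem T2.uniq {S : Type} {W : Stk2 S} {i j : ℕ} (h : T2 W i) (h' : T2 W j) : i = j := by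
  obtain ⟨u, rest, rfl⟩ := h
  obtain ⟨u, rest, h⟩ := h'
  simp at h
  omega

theorem T1_lt {S : Type} {ops : List (Op S)} {W : Stk2 S} {i : ℕ} (h : R ops = some W)
    (ht : T1 W i) : i < ops.length := by
  obtain ⟨a, s, l, u, rest, rfl⟩ := ht
  obtain ⟨k, h1, h2, _⟩ := (inv _ _ h _ _ _ (List.suffix_refl _)).2 _ _ _ _ (List.suffix_refl _)
  omega

theorem T2_lt {S : Type} {ops : List (Op S)} {W : Stk2 S} {i : ℕ} (h : R ops = some W)
    (ht : T2 W i) : i < ops.length := by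
  obtain ⟨u, rest, rfl⟩ := ht
  rcases (inv _ _ h _ _ _ (List.suffix_refl _)).1 with ⟨h1, _⟩ | ⟨k, h1, h2, _⟩ <;> omega

theorem pop1_spec {S : Type} {ops : List (Op S)} {W' : Stk2 S}
    (hR : R (ops ++ [.pop1]) = some W') :
    ∃ W k W2, R ops = some W ∧ T1 W k ∧ k < ops.length ∧ R (ops.take k) = some W2 ∧
      (∀ i, T1 W' i ↔ T1 W2 i) ∧ (∀ i, T2 W' i ↔ T2 W i) := by
  obtain ⟨W, h, hs⟩ := R_snoc _ _ _ hR
  obtain ⟨a, ⟨s, l, p⟩, u, rest, rfl, rfl⟩ := step_pop1 hs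
  obtain ⟨k, rfl, h2, b, r, h3, _⟩ :=
    (inv _ _ h _ _ _ (List.suffix_refl _)).2 _ _ _ _ (List.suffix_refl _)
  refine ⟨_, k, _, h, ⟨_, _, _, _, _, rfl⟩, h2, h3, ?_, ?_⟩
  · intro i; simp [T1]
  · intro i; simp [T2]

theorem pop2_spec {S : Type} {ops : List (Op S)} {W' : Stk2 S}
    (hR : R (ops ++ [.pop2]) = some W') :
    ∃ W k, R ops = some W ∧ T2 W k ∧ k < ops.length ∧ R (ops.take k) = some W' := by
  obtain ⟨W, h, hs⟩ := R_snoc _ _ _ hR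
  obtain ⟨a, u, rfl, hne⟩ := step_pop2 hs
  rcases (inv _ _ h _ _ _ (List.suffix_refl _)).1 with ⟨_, h1⟩ | ⟨k, rfl, h2, h3⟩
  · exact absurd h1 hne
  · exact ⟨_, k, h, ⟨_, _, rfl⟩, h2, h3⟩

theorem collapse_spec {S : Type} {ops : List (Op S)} {W' : Stk2 S}
    (hR : R (ops ++ [.collapse]) = some W') :
    ∃ W k2 W2 k1, R ops = some W ∧ T1 W k2 ∧ k2 < ops.length ∧ R (ops.take k2) = some W2 ∧
      T2 W2 k1 ∧ k1 < k2 ∧ R (ops.take k1) = some W' := by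
  obtain ⟨W, h, hs⟩ := R_snoc _ _ _ hR
  obtain ⟨a, s, l, q, u, rest, rfl, hl, rfl⟩ := step_collapse hs
  obtain ⟨k2, rfl, h2, b, r, h3, h4, h5⟩ :=
    (inv _ _ h _ _ _ (List.suffix_refl _)).2 _ _ _ _ (List.suffix_refl _)
  have hW : ((a, (s, l, (k2 : ℤ)) :: u) :: rest).drop
      (((a, (s, l, (k2 : ℤ)) :: u) :: rest).length - l) = r := by
    have := List.suffix_iff_eq_drop.mp (h4.trans (List.suffix_cons (a, (s, l, (k2 : ℤ)) :: u) rest))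
    rw [h5] at this
    exact this.symm
  rcases (inv _ _ h3 _ _ _ (List.suffix_refl _)).1 with ⟨_, h1⟩ | ⟨k1, rfl, h6, h7⟩
  · subst h1; simp at h5; omega
  · have h6' : k1 < k2 := by simp at h6; omega
    rw [List.take_take, min_eq_left h6'.le] at h7
    exact ⟨_, k2, _, k1, h, ⟨_, _, _, _, _, rfl⟩, h2, h3, ⟨_, _, rfl⟩, h6', by rw [hW, h7]⟩

def M1 {S : Type} (w : List (Op S)) : Prop :=
  ∀ pre W, R (pre ++ w) = some W → T1 W pre.length
def M2 {S : Type} (w : List (Op S)) : Prop :=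
  ∀ pre W, R (pre ++ w) = some W → T2 W pre.length

theorem sound_pop2 {S : Type} {v w pre : List (Op S)} {W : Stk2 S} (hw : M2 w)
    (h : R (pre ++ (v ++ w ++ [.pop2])) = some W) : R (pre ++ v) = some W := by
  have e : pre ++ (v ++ w ++ [.pop2]) = ((pre ++ v) ++ w) ++ [.pop2] := by simp
  rw [e] at h
  obtain ⟨W1, k, h1, h2, h3, h4⟩ := pop2_spec h
  have := T2.uniq h2 (hw _ _ h1)
  subst this
  rwa [List.take_left] at h4

theorem sound_collapse {S : Type} {v w x pre : List (Op S)} {W : Stk2 S} (hw : M2 w) (hx : M1 x)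
    (h : R (pre ++ (v ++ w ++ x ++ [.collapse])) = some W) : R (pre ++ v) = some W := by
  have e : pre ++ (v ++ w ++ x ++ [.collapse]) = (((pre ++ v) ++ w) ++ x) ++ [.collapse] := by simp
  rw [e] at h
  obtain ⟨W1, k2, W2, k1, h1, h2, h3, h4, h5, h6, h7⟩ := collapse_spec h
  have := T1.uniq h2 (hx _ _ h1)
  subst this
  rw [List.take_left] at h4
  have := T2.uniq h5 (hw _ _ h4)
  subst this
  rwa [List.append_assoc, List.take_left] at h7

mutual
theorem sound1 {S : Type} {w : List (Op S)} : InL1 w → M1 w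
  | .base s => by
    intro pre W h
    obtain ⟨W0, h0, hs⟩ := R_snoc _ _ _ h
    obtain ⟨a, u, rest, rfl, rfl⟩ := step_push1 hs
    exact ⟨_, _, _, _, _, rfl⟩
  | .push2 w hw => by
    have ih := sound1 hw
    intro pre W h
    rw [← List.append_assoc] at h
    obtain ⟨W0, h0, hs⟩ := R_snoc _ _ _ h
    obtain ⟨a, u, rest, rfl, rfl⟩ := step_push2 hs
    simpa [T1] using ih _ _ h0
  | .pop1 v w hv hw => by
    have ihv := sound1 hv
    have ihw := sound1 hw
    intro pre W h
    have e : pre ++ (v ++ w ++ [.pop1]) = ((pre ++ v) ++ w) ++ [.pop1] := by simp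
    rw [e] at h
    obtain ⟨W1, k, W2, h1, h2, h3, h4, h5, _⟩ := pop1_spec h
    have := T1.uniq h2 (ihw _ _ h1)
    subst this
    rw [List.take_left] at h4
    exact (h5 _).mpr (ihv _ _ h4)
  | .pop2 v w hv hw => by
    have ihv := sound1 hv
    have ihw := sound2 hw
    intro pre W h
    exact ihv _ _ (sound_pop2 ihw h)
  | .collapse v w x hv hw hx => by
    have ihv := sound1 hv
    have ihw := sound2 hw
    have ihx := sound1 hx
    intro pre W h
    exact ihv _ _ (sound_collapse ihw ihx h)
theorem sound2 {S : Type} {w : List (Op S)} : InL2 w → M2 w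
  | .base => by
    intro pre W h
    obtain ⟨W0, h0, hs⟩ := R_snoc _ _ _ h
    obtain ⟨a, u, rest, rfl, rfl⟩ := step_push2 hs
    exact ⟨_, _, rfl⟩
  | .push1 s w hw => by
    have ih := sound2 hw
    intro pre W h
    rw [← List.append_assoc] at h
    obtain ⟨W0, h0, hs⟩ := R_snoc _ _ _ h
    obtain ⟨a, u, rest, rfl, rfl⟩ := step_push1 hs
    simpa [T2] using ih _ _ h0
  | .pop1 w hw => by
    have ih := sound2 hw
    intro pre W h
    rw [← List.append_assoc] at h
    obtain ⟨W1, k, W2, h1, h2, h3, h4, _, h5⟩ := pop1_spec h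
    exact (h5 _).mpr (ih _ _ h1)
  | .pop2 v w hv hw => by
    have ihv := sound2 hv
    have ihw := sound2 hw
    intro pre W h
    exact ihv _ _ (sound_pop2 ihw h)
  | .collapse v w x hv hw hx => by
    have ihv := sound2 hv
    have ihw := sound2 hw
    have ihx := sound1 hx
    intro pre W h
    exact ihv _ _ (sound_collapse ihw ihx h)
end

theorem split_drop {α : Type} (l : List α) {i k : ℕ} (h : i ≤ k) :
    l.drop i = (l.take k).drop i ++ l.drop k := by
  by_cases hk : k ≤ l.length
  · conv_lhs => rw [← List.take_append_drop k l]
    rw [List.drop_append_of_le_length (by simp; omega)]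
  · rw [List.take_of_length_le (by omega), List.drop_eq_nil_of_le (as := l) (i := k) (by omega)]
    simp

theorem complete {S : Type} (n : ℕ) : ∀ (ops : List (Op S)), ops.length = n → ∀ W i,
    R ops = some W →
    (T1 W i → InL1 (ops.drop i)) ∧ (T2 W i → InL2 (ops.drop i)) := by
  induction n using Nat.strong_induction_on with
  | _ n ih =>
    intro ops' hn W' i hR
    rcases List.eq_nil_or_concat' ops' with rfl | ⟨ops, o, rfl⟩
    · simp only [R, runFrom, initStk, Option.some.injEq] at hR
      subst hR
      constructor
      · rintro ⟨a, s, l, u, rest, h⟩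
        simp at h
      · rintro ⟨u, rest, h⟩
        simp at h
    have hlen : ops.length < n := by simp at hn; omega
    have IH : ∀ k ≤ ops.length, ∀ W i, R (ops.take k) = some W →
        (T1 W i → InL1 ((ops.take k).drop i)) ∧ (T2 W i → InL2 ((ops.take k).drop i)) := by
      intro k hk W i hW
      exact ih _ (by simp; omega) _ rfl W i hW
    have IH0 : ∀ W i, R ops = some W →
        (T1 W i → InL1 (ops.drop i)) ∧ (T2 W i → InL2 (ops.drop i)) :=
      fun W i hW => ih _ hlen _ rfl W i hW
    have hdrop : ∀ i ≤ ops.length, (ops ++ [o]).drop i = ops.drop i ++ [o] :=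
      fun i hi => List.drop_append_of_le_length hi
    cases o with
    | push1 s =>
      obtain ⟨W, h, hs⟩ := R_snoc _ _ _ hR
      obtain ⟨a, u, rest, rfl, rfl⟩ := step_push1 hs
      constructor
      · intro ht
        have := T1.uniq ht ⟨_, _, _, _, _, rfl⟩
        subst this
        simpa using InL1.base s
      · intro ht
        have ht' : T2 ((a, u) :: rest) i := by simpa [T2] using ht
        rw [hdrop i (T2_lt h ht').le]
        exact .push1 _ _ ((IH0 _ _ h).2 ht')
    | push2 =>
      obtain ⟨W, h, hs⟩ := R_snoc _ _ _ hR
      obtain ⟨a, u, rest, rfl, rfl⟩ := step_push2 hs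
      constructor
      · intro ht
        have ht' : T1 ((a, u) :: rest) i := by simpa [T1] using ht
        rw [hdrop i (T1_lt h ht').le]
        exact .push2 _ ((IH0 _ _ h).1 ht')
      · intro ht
        have := T2.uniq ht ⟨_, _, rfl⟩
        subst this
        simpa using InL2.base
    | pop1 =>
      obtain ⟨W, k, W2, h1, h2, h3, h4, h5, h6⟩ := pop1_spec hR
      constructor
      · intro ht
        have ht' := (h5 i).mp ht
        have hik := T1_lt h4 ht'
        simp at hik
        rw [hdrop i (by omega), split_drop ops (show i ≤ k by omega)]
        exact .pop1 _ _ ((IH k h3.le _ _ h4).1 ht') ((IH0 _ _ h1).1 h2)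
      · intro ht
        have ht' := (h6 i).mp ht
        rw [hdrop i (T2_lt h1 ht').le]
        exact .pop1 _ ((IH0 _ _ h1).2 ht')
    | pop2 =>
      obtain ⟨W, k, h1, h2, h3, h4⟩ := pop2_spec hR
      constructor
      · intro ht
        have hik := T1_lt h4 ht
        simp at hik
        rw [hdrop i (by omega), split_drop ops (show i ≤ k by omega)]
        exact .pop2 _ _ ((IH k h3.le _ _ h4).1 ht) ((IH0 _ _ h1).2 h2)
      · intro ht
        have hik := T2_lt h4 ht
        simp at hik
        rw [hdrop i (by omega), split_drop ops (show i ≤ k by omega)]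
        exact .pop2 _ _ ((IH k h3.le _ _ h4).2 ht) ((IH0 _ _ h1).2 h2)
    | collapse =>
      obtain ⟨W, k2, W2, k1, h1, h2, h3, h4, h5, h6, h7⟩ := collapse_spec hR
      have e : ∀ i ≤ k1, ops.drop i
          = (ops.take k1).drop i ++ (ops.take k2).drop k1 ++ ops.drop k2 := by
        intro i hi
        rw [split_drop ops (show i ≤ k2 by omega), split_drop (ops.take k2) hi, List.take_take,
          min_eq_left h6.le]
      constructor
      · intro ht
        have hik := T1_lt h7 ht
        simp at hik
        rw [hdrop i (by omega), e i (by omega)]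
        exact .collapse _ _ _ ((IH k1 (by omega) _ _ h7).1 ht) ((IH k2 h3.le _ _ h4).2 h5)
          ((IH0 _ _ h1).1 h2)
      · intro ht
        have hik := T2_lt h7 ht
        simp at hik
        rw [hdrop i (by omega), e i (by omega)]
        exact .collapse _ _ _ ((IH k1 (by omega) _ _ h7).2 ht) ((IH k2 h3.le _ _ h4).2 h5)
          ((IH0 _ _ h1).1 h2)

end Stk

/-- For a valid sequence `op_0 ⋯ op_n` of order-2 stack operations and all
`0 ≤ i ≤ j ≤ n`: `push1(j) = i` iff the factor `op_i ⋯ op_j` belongs to `L1`. -/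
theorem push1_eq_iff_mem_L1 {S : Type} (ops : List (Op S)) (hv : Valid ops)
    (i j : ℕ) (hij : i ≤ j) (hj : j < ops.length) :
    push1At ops (j : ℤ) = (i : ℤ) ↔ InL1 (factor ops i j) := by
  obtain ⟨Wf, hWf⟩ := Option.isSome_iff_exists.mp hv.2
  have hWf' : Stk.R (ops.take (j + 1) ++ ops.drop (j + 1)) = some Wf := by
    rw [List.take_append_drop]; exact hWf
  obtain ⟨W, hW⟩ := Stk.R_append _ _ _ hWf'
  have hs : stkAt ops (j : ℤ) = some W := by
    unfold stkAt
    have : ((j : ℤ) + 1).toNat = j + 1 := by omega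
    rw [this]; exact hW
  have hf : factor ops i j = (ops.take (j + 1)).drop i := by
    unfold factor
    rw [List.drop_take]
  have hp : push1At ops (j : ℤ) = (i : ℤ) ↔ Stk.T1 W i := by
    unfold push1At
    rw [hs]
    rcases W with _ | ⟨⟨a, _ | ⟨⟨s, l, p⟩, u⟩⟩, rest⟩
    · simp [Stk.T1]
    · simp [Stk.T1]
    · simp [Stk.T1]
  rw [hp, hf]
  constructor
  · exact (Stk.complete _ _ rfl _ _ hW).1
  · intro h
    have hi : ((ops.take (j + 1)).take i).length = i := by simp; omega
    have := Stk.sound1 h ((ops.take (j + 1)).take i) W (by rw [List.take_append_drop]; exact hW)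
    rwa [hi] at this
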